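/- There exists a constant C > 0 such that K_1(0,y) ≥ (1/C) · cos(πy/2) for all y ∈ (-1,1). -/

import Mathlib

open Real Set

/-- The Dirichlet heat kernel of the interval `[-1,1]`:
`K t x y = (4πt)^{-1/2} (∑_{k ∈ ℤ} e^{-(x-y+4k)²/(4t)} − ∑_{k ∈ ℤ} e^{-(x+y+4k-2)²/(4t)})`. -/
noncomputable def K (t x y : ℝ) : ℝ :=
  (Real.sqrt (4 * Real.pi * t))⁻¹ *
    ((∑' k : ℤ, Real.exp (-(x - y + 4 * (k : ℝ)) ^ 2 / (4 * t))) -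
     (∑' k : ℤ, Real.exp (-(x + y + 4 * (k : ℝ) - 2) ^ 2 / (4 * t))))

/-- The difference of Gaussians centred at `±u`. -/
noncomputable def hkG (u m : ℝ) : ℝ :=
  Real.exp (-(m - u) ^ 2 / 4) - Real.exp (-(m + u) ^ 2 / 4)

lemma hkG_eq (u m : ℝ) :
    hkG u m = 2 * Real.exp (-(m ^ 2 + u ^ 2) / 4) * Real.sinh (m * (u / 2)) := by
  unfold hkG
  rw [Real.sinh_eq]
  have h1 : -(m - u) ^ 2 / 4 = -(m ^ 2 + u ^ 2) / 4 + m * (u / 2) := by ring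
  have h2 : -(m + u) ^ 2 / 4 = -(m ^ 2 + u ^ 2) / 4 + -(m * (u / 2)) := by ring
  rw [h1, h2, Real.exp_add, Real.exp_add]
  ring

lemma hk_sinh (m v : ℝ) (hm : 1 ≤ m) (hv : 0 ≤ v) (hv1 : v ≤ 1 / 2) :
    Real.sinh ((m + 2) * v) ≤ 5 * Real.sinh (m * v) := by
  have h0 : 0 ≤ Real.sinh ((m - 1) * v) :=
    Real.sinh_nonneg_iff.2 (mul_nonneg (by linarith) hv)
  have hs : 0 ≤ Real.sinh (m * v) := Real.sinh_nonneg_iff.2 (mul_nonneg (by linarith) hv)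
  have e1 : (m - 1) * v = m * v - v := by ring
  have e2 : (m + 2) * v = m * v + 2 * v := by ring
  rw [e1, Real.sinh_sub] at h0
  rw [e2, Real.sinh_add, Real.sinh_two_mul]
  have hc0 : 0 < Real.cosh v := Real.cosh_pos v
  have hcsq := Real.cosh_sq v
  have hc2 := Real.cosh_two_mul v
  have hc : Real.cosh (2 * v) ≤ 2 := by
    have : Real.cosh (2 * v) ≤ Real.cosh 1 := by
      rw [Real.cosh_le_cosh, abs_of_nonneg (by linarith), abs_one]; linarith
    refine this.trans ?_
    rw [Real.cosh_eq]
    have a := Real.exp_one_lt_d9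
    have b : Real.exp (-1) ≤ 1 := Real.exp_le_one_iff.2 (by norm_num)
    linarith
  nlinarith [mul_nonneg h0 hc0.le, mul_nonneg hs (sub_nonneg.2 hc)]

lemma hkG_step (u m : ℝ) (hm : 1 ≤ m) (hu : 0 ≤ u) (hu1 : u ≤ 1) :
    0 ≤ hkG u m ∧ hkG u (m + 2) ≤ 5 / 7 * hkG u m := by
  have hs : 0 ≤ Real.sinh (m * (u / 2)) :=
    Real.sinh_nonneg_iff.2 (mul_nonneg (by linarith) (by linarith))
  have hst := hk_sinh m (u / 2) hm (by linarith) (by linarith)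
  have hE := Real.exp_pos (-(m ^ 2 + u ^ 2) / 4)
  rw [hkG_eq, hkG_eq]
  refine ⟨by positivity, ?_⟩
  have e : -((m + 2) ^ 2 + u ^ 2) / 4 = -(m ^ 2 + u ^ 2) / 4 + -(m + 1) := by ring
  rw [e, Real.exp_add]
  have h7 : Real.exp (-(m + 1)) ≤ 1 / 7 := by
    have h : Real.exp (-(m + 1)) ≤ Real.exp (-2) := Real.exp_le_exp.2 (by linarith)
    refine h.trans ?_
    rw [Real.exp_neg, one_div]
    apply inv_anti₀ (by norm_num)
    have : Real.exp 2 = Real.exp 1 * Real.exp 1 := by rw [← Real.exp_add]; norm_num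
    rw [this]
    nlinarith [Real.exp_one_gt_d9]
  calc 2 * (Real.exp (-(m ^ 2 + u ^ 2) / 4) * Real.exp (-(m + 1))) * Real.sinh ((m + 2) * (u / 2))
      ≤ 2 * (Real.exp (-(m ^ 2 + u ^ 2) / 4) * Real.exp (-(m + 1))) *
          (5 * Real.sinh (m * (u / 2))) := by gcongr
    _ ≤ 2 * (Real.exp (-(m ^ 2 + u ^ 2) / 4) * (1 / 7)) *
          (5 * Real.sinh (m * (u / 2))) := by gcongr
    _ = _ := by ring

lemma hkG_one (u : ℝ) (hu : 0 ≤ u) (hu1 : u ≤ 1) : Real.exp (-1 / 2) * u ≤ hkG u 1 := by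
  rw [hkG_eq]
  have h1 : u / 2 ≤ Real.sinh (1 * (u / 2)) := by
    rw [one_mul]; exact Real.self_le_sinh_iff.2 (by linarith)
  have h2 : Real.exp (-1 / 2) ≤ Real.exp (-(1 ^ 2 + u ^ 2) / 4) :=
    Real.exp_le_exp.2 (by nlinarith)
  calc Real.exp (-1 / 2) * u = 2 * Real.exp (-1 / 2) * (u / 2) := by ring
    _ ≤ _ := by gcongr

lemma hk_summable (a : ℝ) : Summable fun k : ℤ => Real.exp (-(a + 4 * (k : ℝ)) ^ 2 / 4) := by
  have h : Summable fun k : ℤ => Real.exp (1 + |a|) * Real.exp (-|(k : ℝ)|) := by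
    apply Summable.mul_left
    apply Summable.of_nat_of_neg
    · simpa using Real.summable_exp_neg_nat
    · simpa using Real.summable_exp_neg_nat
  refine Summable.of_nonneg_of_le (fun _ => (Real.exp_pos _).le) (fun k => ?_) h
  rw [← Real.exp_add]
  apply Real.exp_le_exp.2
  have h1 : |4 * (k : ℝ)| ≤ |a + 4 * (k : ℝ)| + |a| := by
    have := abs_sub (a + 4 * (k : ℝ)) a
    simpa using this
  rw [abs_mul, abs_of_pos (by norm_num : (0 : ℝ) < 4)] at h1
  have h2 := sq_abs (a + 4 * (k : ℝ))
  nlinarith [sq_nonneg (|a + 4 * (k : ℝ)| - 2), abs_nonneg (k : ℝ)]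

lemma hk_neg (y : ℝ) : K 1 0 (-y) = K 1 0 y := by
  unfold K
  congr 2
  · rw [← (Equiv.neg ℤ).tsum_eq]
    apply tsum_congr
    intro k
    simp only [Equiv.neg_apply]
    push_cast
    congr 2
    ring
  · rw [← (Equiv.subLeft (1 : ℤ)).tsum_eq]
    apply tsum_congr
    intro k
    simp only [Equiv.subLeft_apply]
    push_cast
    congr 2
    ring

lemma hk_nonneg (y : ℝ) (h0 : 0 ≤ y) (h1 : y < 1) :
    (Real.sqrt (4 * Real.pi * 1))⁻¹ * (2 / 7 * (Real.exp (-1 / 2) * (1 - y))) ≤ K 1 0 y := by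
  unfold K
  apply mul_le_mul_of_nonneg_left _ (by positivity)
  set u := 1 - y with hu
  have hA : Summable fun k : ℤ => Real.exp (-(0 - y + 4 * (k : ℝ)) ^ 2 / (4 * 1)) := by
    simpa using hk_summable (0 - y)
  have hB : Summable fun k : ℤ => Real.exp (-(0 + y + 4 * (k : ℝ) - 2) ^ 2 / (4 * 1)) := by
    refine (hk_summable (y - 2)).congr fun k => ?_
    congr 1; ring
  rw [← hA.tsum_sub hB, ← (Equiv.neg ℤ).tsum_eq]
  have hS := (Equiv.neg ℤ).summable_iff.2 (hA.sub hB)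
  have hD : ∀ k : ℤ, Real.exp (-(0 - y + 4 * (((Equiv.neg ℤ) k : ℤ) : ℝ)) ^ 2 / (4 * 1)) -
      Real.exp (-(0 + y + 4 * (((Equiv.neg ℤ) k : ℤ) : ℝ) - 2) ^ 2 / (4 * 1)) =
      hkG u (4 * (k : ℝ) + 1) := by
    intro k
    unfold hkG
    simp only [Equiv.neg_apply]
    push_cast
    rw [hu]
    congr 1
    · apply congrArg; ring
    · apply congrArg; ring
  have hS' : Summable fun k : ℤ => hkG u (4 * (k : ℝ) + 1) := hS.congr hD
  rw [tsum_congr hD]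
  have hp : Summable fun n : ℕ => hkG u (4 * ((n : ℤ) : ℝ) + 1) :=
    hS'.comp_injective Nat.cast_injective
  have hn : Summable fun n : ℕ => hkG u (4 * ((-((n : ℤ) + 1) : ℤ) : ℝ) + 1) :=
    hS'.comp_injective (i := fun n : ℕ => (-((n : ℤ) + 1) : ℤ)) (fun a b h => by
      simp only at h; omega)
  rw [tsum_of_nat_of_neg_add_one (f := fun k : ℤ => hkG u (4 * (k : ℝ) + 1)) hp hn,
    ← hp.tsum_add hn]
  have hpair : ∀ n : ℕ, hkG u (4 * ((n : ℤ) : ℝ) + 1) +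
      hkG u (4 * ((-((n : ℤ) + 1) : ℤ) : ℝ) + 1) ≥ 2 / 7 * hkG u (4 * (n : ℝ) + 1) ∧
      0 ≤ hkG u (4 * (n : ℝ) + 1) := by
    intro n
    have hn0 : (0 : ℝ) ≤ n := Nat.cast_nonneg n
    have hst := hkG_step u (4 * (n : ℝ) + 1) (by linarith) (by linarith) (by linarith)
    have e : hkG u (4 * ((-((n : ℤ) + 1) : ℤ) : ℝ) + 1) = - hkG u (4 * (n : ℝ) + 1 + 2) := by
      unfold hkG
      push_cast
      rw [neg_sub]
      congr 2 <;> ring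
    rw [e]
    push_cast
    exact ⟨by linarith [hst.2], hst.1⟩
  have h00 := (hp.add hn).le_tsum 0 (fun n _ => by
    have := hpair n
    linarith [this.1, this.2])
  refine le_trans ?_ h00
  have := (hpair 0).1
  have g1 := hkG_one u (by linarith) (by linarith)
  have e0 : (4 * ((0 : ℕ) : ℝ) + 1) = 1 := by norm_num
  rw [e0] at this
  linarith

lemma hk_final (y : ℝ) (h0 : 0 ≤ y) (h1 : y < 1) :
    (Real.sqrt (4 * Real.pi * 1))⁻¹ * (2 / 7 * (Real.exp (-1 / 2) * (2 / Real.pi))) *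
      Real.cos (Real.pi * y / 2) ≤ K 1 0 y := by
  refine le_trans ?_ (hk_nonneg y h0 h1)
  have hc : Real.cos (Real.pi * y / 2) ≤ Real.pi / 2 * (1 - y) := by
    rw [← Real.sin_pi_div_two_sub]
    refine (Real.sin_le ?_).trans (le_of_eq (by ring))
    nlinarith [Real.pi_pos]
  calc _ ≤ (Real.sqrt (4 * Real.pi * 1))⁻¹ * (2 / 7 * (Real.exp (-1 / 2) * (2 / Real.pi))) *
      (Real.pi / 2 * (1 - y)) := by gcongr
    _ = _ := by
      have := Real.pi_ne_zero
      field_simp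

/-- There is a constant `C > 0` such that `K_1(0,y) ≥ (1/C) cos(πy/2)` for all `y ∈ (-1,1)`. -/
theorem heat_kernel_lower_bound :
    ∃ C > (0 : ℝ), ∀ y ∈ Set.Ioo (-1 : ℝ) 1,
      K 1 0 y ≥ (1 / C) * Real.cos (Real.pi * y / 2) := by
  refine ⟨((Real.sqrt (4 * Real.pi * 1))⁻¹ *
    (2 / 7 * (Real.exp (-1 / 2) * (2 / Real.pi))))⁻¹, by positivity, fun y hy => ?_⟩
  rw [one_div, inv_inv]
  rcases le_total 0 y with h | h
  · exact hk_final y h hy.2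
  · have := hk_final (-y) (by linarith) (by linarith [hy.1])
    rw [hk_neg] at this
    have e : Real.pi * -y / 2 = -(Real.pi * y / 2) := by ring
    rw [e, Real.cos_neg] at this
    exact this
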